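/- For all s in (0, 2π), 2·s − 3·sin(s) + s·cos(s) ≥ 0. -/

import Mathlib

theorem nonneg_of_deriv_aux (f f' : ℝ → ℝ) (h0 : f 0 = 0) (hd : ∀ x, HasDerivAt f (f' x) x)
    (hn : ∀ x, 0 ≤ x → x ≤ Real.pi → 0 ≤ f' x) : ∀ x, 0 ≤ x → x ≤ Real.pi → 0 ≤ f x := by
  intro x hx hxp
  have hm : MonotoneOn f (Set.Icc 0 Real.pi) := by
    apply monotoneOn_of_deriv_nonneg (convex_Icc _ _)
    · exact fun y _ => (hd y).continuousAt.continuousWithinAt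
    · exact fun y _ => (hd y).differentiableAt.differentiableWithinAt
    · intro y hy
      rw [interior_Icc] at hy
      rw [(hd y).deriv]
      exact hn y hy.1.le hy.2.le
  have := hm ⟨le_rfl, Real.pi_pos.le⟩ ⟨hx, hxp⟩ hx
  rwa [h0] at this

theorem stmt_5 (s : ℝ) (hs0 : 0 < s) (hs2pi : s < 2 * Real.pi) :
    2 * s - 3 * Real.sin s + s * Real.cos s ≥ 0 := by
  rcases le_total s Real.pi with h | h
  · have h2 := nonneg_of_deriv_aux (fun x => Real.sin x - x * Real.cos x)
      (fun x => x * Real.sin x) (by simp)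
      (fun x => by
        refine HasDerivAt.congr_deriv ((Real.hasDerivAt_sin x).sub ((hasDerivAt_id x).mul (Real.hasDerivAt_cos x))) ?_
        simp only [id]; ring)
      (fun x hx hxp => mul_nonneg hx (Real.sin_nonneg_of_nonneg_of_le_pi hx hxp))
    have h1 := nonneg_of_deriv_aux (fun x => 2 - 2 * Real.cos x - x * Real.sin x)
      (fun x => Real.sin x - x * Real.cos x) (by simp)
      (fun x => by
        refine HasDerivAt.congr_deriv ((((Real.hasDerivAt_cos x).const_mul 2).const_sub 2).sub
          ((hasDerivAt_id x).mul (Real.hasDerivAt_sin x))) ?_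
        simp only [id]; ring) h2
    exact nonneg_of_deriv_aux (fun x => 2 * x - 3 * Real.sin x + x * Real.cos x)
      (fun x => 2 - 2 * Real.cos x - x * Real.sin x) (by simp)
      (fun x => by
        refine HasDerivAt.congr_deriv ((((hasDerivAt_id x).const_mul 2).sub ((Real.hasDerivAt_sin x).const_mul 3)).add
          ((hasDerivAt_id x).mul (Real.hasDerivAt_cos x))) ?_
        simp only [id]; ring) h1 s hs0.le h
  · have hsin : Real.sin s ≤ 0 := by
      have := Real.sin_nonneg_of_nonneg_of_le_pi (x := s - Real.pi) (by linarith) (by linarith)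
      rw [Real.sin_sub_pi] at this
      linarith
    nlinarith [Real.neg_one_le_cos s]
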